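/- arXiv:2509.04543 — 2 statements merged into one kernel-verified Lean document; each statement's English description precedes it below -/
import Mathlib

section
/- In the example metagraph H, the edge set {e_1, e_2, e_5} is a dominant metapath from {x_1, x_7} to {x_8} (this is the dominant metapath omitted in Basu and Blanning's published computation of the projection). -/
/-- An edge of a metagraph: an invertex set and an outvertex set. -/
structure MEdge (α : Type*) where
  inv : Set α
  out : Set α

namespace MG

variable {α : Type*}

/-- `p` is a simple path from `x` to `y` using edges from `E`:
a nonempty sequence of edges of `E` with `x` in the invertex of the first edge,
`y` in the outvertex of the last edge, and consecutive edges sharing an element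
(outvertex of one meets invertex of the next). -/
def IsSimplePath (E : Set (MEdge α)) (p : List (MEdge α)) (x y : α) : Prop :=
  p ≠ [] ∧ (∀ e ∈ p, e ∈ E) ∧
  (∀ h : p ≠ [], x ∈ (p.head h).inv ∧ y ∈ (p.getLast h).out) ∧
  p.Chain' (fun e f => (e.out ∩ f.inv).Nonempty)

/-- Clauses (2) and (3) of the metapath definition: the pure inputs of `E'`
are contained in the source `B`, and the target `C` is covered by the union of
the outvertices. -/
def IsRelaxedMetapath (E : Set (MEdge α)) (B C : Set α) (E' : Set (MEdge α)) : Prop :=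
  E' ⊆ E ∧
  ((⋃ e ∈ E', e.inv) \ (⋃ e ∈ E', e.out)) ⊆ B ∧
  C ⊆ ⋃ e ∈ E', e.out

/-- Full metapath definition: clauses (2) and (3) together with clause (1),
that every edge of `E'` lies on a simple path (within `E'`) from some element
of `B` to some element of `C`. -/
def IsMetapath (E : Set (MEdge α)) (B C : Set α) (E' : Set (MEdge α)) : Prop :=
  IsRelaxedMetapath E B C E' ∧
  ∀ e ∈ E', ∃ (p : List (MEdge α)) (x y : α),
    x ∈ B ∧ y ∈ C ∧ e ∈ p ∧ IsSimplePath E' p x y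

/-- Edge-dominance: no proper subset of `E'` is a metapath from `B` to `C`. -/
def IsEdgeDominant (E : Set (MEdge α)) (B C : Set α) (E' : Set (MEdge α)) : Prop :=
  IsMetapath E B C E' ∧ ∀ F, F ⊂ E' → ¬ IsMetapath E B C F

/-- Input-dominance: there is no metapath from a proper subset of `B` to `C`. -/
def IsInputDominant (E : Set (MEdge α)) (B C : Set α) (E' : Set (MEdge α)) : Prop :=
  IsMetapath E B C E' ∧ ∀ B', B' ⊂ B → ∀ F, ¬ IsMetapath E B' C F

/-- Dominance: edge-dominant and input-dominant. -/
def IsDominant (E : Set (MEdge α)) (B C : Set α) (E' : Set (MEdge α)) : Prop :=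
  IsEdgeDominant E B C E' ∧ IsInputDominant E B C E'

/-- Edge-dominance with respect to the relaxed metapath definition. -/
def IsRelaxedEdgeDominant (E : Set (MEdge α)) (B C : Set α) (E' : Set (MEdge α)) : Prop :=
  IsRelaxedMetapath E B C E' ∧ ∀ F, F ⊂ E' → ¬ IsRelaxedMetapath E B C F

/-- Input-dominance with respect to the relaxed metapath definition. -/
def IsRelaxedInputDominant (E : Set (MEdge α)) (B C : Set α) (E' : Set (MEdge α)) : Prop :=
  IsRelaxedMetapath E B C E' ∧ ∀ B', B' ⊂ B → ∀ F, ¬ IsRelaxedMetapath E B' C F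

/-- Dominance with respect to the relaxed metapath definition. -/
def IsRelaxedDominant (E : Set (MEdge α)) (B C : Set α) (E' : Set (MEdge α)) : Prop :=
  IsRelaxedEdgeDominant E B C E' ∧ IsRelaxedInputDominant E B C E'

/-- Edge set of the Basu–Blanning projection of the metagraph with edge set `E`
over `X'`: for each invertex `V' ⊆ X'` of some dominant metapath `M(V',{x'})`
with `x' ∈ X'`, one edge `⟨V', W'⟩` where `W'` collects all such targets `x'`. -/
def BBP (E : Set (MEdge α)) (X' : Set α) : Set (MEdge α) :=
  { e | e.inv ⊆ X' ∧ (∃ x' ∈ X', ∃ M, IsDominant E e.inv {x'} M) ∧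
        e.out = { x' | x' ∈ X' ∧ ∃ M, IsDominant E e.inv {x'} M } }

/-- A metapath `M` with target `{x'}` is irreducible w.r.t. `X'` if no proper
subset of its edges forms a metapath `M(U,{x'})` with `U ⊆ X'`. -/
def Irreducible (E : Set (MEdge α)) (X' : Set α) (x' : α) (M : Set (MEdge α)) : Prop :=
  ¬ ∃ F, F ⊂ M ∧ ∃ U, U ⊆ X' ∧ IsMetapath E U {x'} F

/-- Edge set of the transitivity preserving projection of the metagraph with
edge set `E` over `X'`: as the Basu–Blanning projection, but collecting only
the irreducible dominant metapaths. -/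
def TPP (E : Set (MEdge α)) (X' : Set α) : Set (MEdge α) :=
  { e | e.inv ⊆ X' ∧
        (∃ x' ∈ X', ∃ M, IsDominant E e.inv {x'} M ∧ Irreducible E X' x' M) ∧
        e.out = { x' | x' ∈ X' ∧ ∃ M, IsDominant E e.inv {x'} M ∧ Irreducible E X' x' M } }

end MG

/-- Edges of the example metagraph (element `x_i` is represented by `i : ℕ`). -/
def e1 : MEdge ℕ := ⟨{1}, {3, 4}⟩
def e2 : MEdge ℕ := ⟨{3}, {6}⟩
def e3 : MEdge ℕ := ⟨{2}, {5}⟩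
def e4 : MEdge ℕ := ⟨{4, 5}, {7}⟩
def e5 : MEdge ℕ := ⟨{6, 7}, {8}⟩

/-- The edge set of the example metagraph `H`. -/
def Eex : Set (MEdge ℕ) := {e1, e2, e3, e4, e5}

/-- The projection set `X' = {x_1, x_2, x_6, x_7, x_8}`. -/
def Xex' : Set ℕ := {1, 2, 6, 7, 8}

namespace MG

variable {α : Type*} {E F : Set (MEdge α)} {B C : Set α}

/-- In a relaxed metapath, every invertex element of an edge is a source element or is produced
by some edge. -/
theorem IsRelaxedMetapath.mem_source_or_exists_mem_out (h : IsRelaxedMetapath E B C F)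
    {e : MEdge α} (he : e ∈ F) {x : α} (hx : x ∈ e.inv) : x ∈ B ∨ ∃ f ∈ F, x ∈ f.out := by
  by_contra! hcon
  refine hcon.1 (h.2.1 ⟨Set.mem_biUnion he hx, fun hout => ?_⟩)
  obtain ⟨f, hf, hxf⟩ := Set.mem_iUnion₂.1 hout
  exact hcon.2 f hf hxf

/-- In a relaxed metapath, every target element is produced by some edge. -/
theorem IsRelaxedMetapath.exists_mem_out (h : IsRelaxedMetapath E B C F) {y : α} (hy : y ∈ C) :
    ∃ f ∈ F, y ∈ f.out := by
  obtain ⟨f, hf, hyf⟩ := Set.mem_iUnion₂.1 (h.2.2 hy)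
  exact ⟨f, hf, hyf⟩

end MG

/-- Every element of an outvertex in the example metagraph determines the edge producing it. -/
theorem mem_out_of_mem_Eex {f : MEdge ℕ} (hf : f ∈ Eex) {x : ℕ} (hx : x ∈ f.out) :
    (x = 3 ∨ x = 4) ∧ f = e1 ∨ x = 6 ∧ f = e2 ∨ x = 5 ∧ f = e3 ∨ x = 7 ∧ f = e4 ∨
      x = 8 ∧ f = e5 := by
  rcases hf with rfl | rfl | rfl | rfl | rfl <;>
    simp only [e1, e2, e3, e4, e5, Set.mem_insert_iff, Set.mem_singleton_iff] at hx <;> simp [hx]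

/-- A relaxed metapath to `x₈` whose sources lie in `{x₁, x₇}` contains `e₁, e₂, e₅` and uses both
sources. -/
theorem subset_of_isRelaxedMetapath {B : Set ℕ} {F : Set (MEdge ℕ)} (hB : B ⊆ {1, 7})
    (h : MG.IsRelaxedMetapath Eex B {8} F) : {e1, e2, e5} ⊆ F ∧ {1, 7} ⊆ B := by
  have step {e : MEdge ℕ} (he : e ∈ F) {x : ℕ} (hx : x ∈ e.inv) : x ∈ B ∨ ∃ f ∈ F,
      ((x = 3 ∨ x = 4) ∧ f = e1 ∨ x = 6 ∧ f = e2 ∨ x = 5 ∧ f = e3 ∨ x = 7 ∧ f = e4 ∨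
        x = 8 ∧ f = e5) :=
    (h.mem_source_or_exists_mem_out he hx).imp_right fun ⟨f, hf, hxf⟩ =>
      ⟨f, hf, mem_out_of_mem_Eex (h.1 hf) hxf⟩
  have not_source {x : ℕ} (h1 : x ≠ 1) (h7 : x ≠ 7) : x ∉ B := fun hx => (hB hx).elim h1 h7
  have h5 : e5 ∈ F := by
    obtain ⟨f, hf, hxf⟩ := h.exists_mem_out (Set.mem_singleton 8)
    have := mem_out_of_mem_Eex (h.1 hf) hxf
    simp_all
  have h2 : e2 ∈ F := by
    simpa [not_source] using step h5 (x := 6) (by simp [e5])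
  have h1 : e1 ∈ F := by
    simpa [not_source] using step h2 (x := 3) (by simp [e2])
  have b1 : 1 ∈ B := by
    simpa using step h1 (x := 1) (by simp [e1])
  have b7 : 7 ∈ B := by
    by_contra hn
    have h4 : e4 ∈ F := by
      simpa [hn] using step h5 (x := 7) (by simp [e5])
    have h3 : e3 ∈ F := by
      simpa [not_source] using step h4 (x := 5) (by simp [e4])
    simpa [not_source] using step h3 (x := 2) (by simp [e3])
  simp [Set.insert_subset_iff, h1, h2, h5, b1, b7]

theorem isMetapath_e1_e2_e5 : MG.IsMetapath Eex {1, 7} {8} {e1, e2, e5} := by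
  refine ⟨⟨?_, ?_, ?_⟩, fun e he => ⟨[e1, e2, e5], 1, 8, by simp, rfl, by simpa using he,
    by simp, by simp, ?_, ?_⟩⟩
  · simp [Set.insert_subset_iff, Eex]
  · rintro x ⟨hin, hout⟩
    simp [e1, e2, e5] at hin hout ⊢
    omega
  · simp [e5]
  · simp [e1, e5]
  · simp [List.Chain', e1, e2, e5, Set.Nonempty]

/-- In the example metagraph `H`, the edge set `{e_1, e_2, e_5}` is a dominant
metapath from `{x_1, x_7}` to `{x_8}`. -/
theorem stmt_5 : MG.IsDominant Eex {1, 7} {8} {e1, e2, e5} :=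
  ⟨⟨isMetapath_e1_e2_e5, fun _ hF h => hF.not_subset (subset_of_isRelaxedMetapath subset_rfl h.1).1⟩,
    isMetapath_e1_e2_e5, fun _ hB _ h =>
      hB.not_subset (subset_of_isRelaxedMetapath hB.subset h.1).2⟩
end

section
/- The transitivity preserving projection is idempotent: if H = ⟨X,E⟩ is a metagraph with X finite, X' ⊆ X, and H' = ⟨X',E'⟩ is the transitivity preserving projection of H over X', then the transitivity preserving projection of H' over X' is equal to H'. -/
namespace MG

variable {α : Type*}

/-- One step of reachability between elements through an edge of `M`. -/
def Step (M : Set (MEdge α)) (a c : α) : Prop :=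
  ∃ g ∈ M, a ∈ g.inv ∧ c ∈ g.out

/-- Reachability between elements through edges of `M`. -/
abbrev Reach (M : Set (MEdge α)) : α → α → Prop :=
  Relation.ReflTransGen (Step M)

theorem Reach.mono {M N : Set (MEdge α)} (h : M ⊆ N) {a c : α} (hr : Reach M a c) :
    Reach N a c :=
  Relation.ReflTransGen.mono (fun _ _ ⟨g, hg, hac⟩ => ⟨g, h hg, hac⟩) _ _ hr

theorem isSimplePath_singleton {M : Set (MEdge α)} {e : MEdge α} {x y : α} :
    IsSimplePath M [e] x y ↔ e ∈ M ∧ x ∈ e.inv ∧ y ∈ e.out := by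
  simp [IsSimplePath, List.Chain']

theorem isSimplePath_cons_cons {M : Set (MEdge α)} {e f : MEdge α} {l : List (MEdge α)}
    {x y : α} :
    IsSimplePath M (e :: f :: l) x y ↔
      e ∈ M ∧ x ∈ e.inv ∧ ∃ z ∈ e.out, IsSimplePath M (f :: l) z y := by
  simp only [IsSimplePath, List.Chain', List.isChain_cons_cons, Set.Nonempty, Set.mem_inter_iff,
    List.mem_cons, List.head_cons, List.getLast_cons_cons, ne_eq, reduceCtorEq,
    not_false_eq_true, forall_true_left, true_and]
  grind

theorem IsSimplePath.cons {M : Set (MEdge α)} {e : MEdge α} {p : List (MEdge α)} {x y z : α}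
    (hp : IsSimplePath M p z y) (he : e ∈ M) (hx : x ∈ e.inv) (hz : z ∈ e.out) :
    IsSimplePath M (e :: p) x y := by
  cases p with
  | nil => exact absurd rfl hp.1
  | cons f l => exact isSimplePath_cons_cons.2 ⟨he, hx, z, hz, hp⟩

theorem IsSimplePath.exists_reach {M : Set (MEdge α)} {p : List (MEdge α)} {x y : α}
    (hp : IsSimplePath M p x y) {e : MEdge α} (he : e ∈ p) :
    (∃ u ∈ e.inv, Reach M x u) ∧ ∃ w ∈ e.out, Reach M w y := by
  induction p generalizing x e with
  | nil => simp at he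
  | cons f l ih =>
    cases l with
    | nil =>
      obtain rfl : e = f := by simpa using he
      obtain ⟨_, hx, hy⟩ := isSimplePath_singleton.1 hp
      exact ⟨⟨x, hx, .refl⟩, y, hy, .refl⟩
    | cons g l =>
      obtain ⟨hf, hx, z, hz, hp'⟩ := isSimplePath_cons_cons.1 hp
      rcases List.mem_cons.1 he with rfl | he
      · obtain ⟨_, w, hw, hwy⟩ := ih hp' List.mem_cons_self
        have hzg : z ∈ g.inv := (hp'.2.2.1 hp'.1).1
        exact ⟨⟨x, hx, .refl⟩, z, hz,
          .head ⟨g, hp'.2.1 g List.mem_cons_self, hzg, hw⟩ hwy⟩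
      · obtain ⟨⟨u, hu, hzu⟩, hw⟩ := ih hp' he
        exact ⟨⟨u, hu, .head ⟨f, hf, hx, hz⟩ hzu⟩, hw⟩

theorem exists_isSimplePath_cons {M : Set (MEdge α)} {w y : α} (hwy : Reach M w y) :
    ∀ {e : MEdge α} {u : α}, e ∈ M → u ∈ e.inv → w ∈ e.out →
      ∃ l, IsSimplePath M (e :: l) u y := by
  induction hwy using Relation.ReflTransGen.head_induction_on with
  | refl => exact fun he hu hy => ⟨[], isSimplePath_singleton.2 ⟨he, hu, hy⟩⟩
  | head h _ ih =>
    intro e u he hu hw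
    obtain ⟨g, hg, hag, hcg⟩ := h
    obtain ⟨l, hl⟩ := ih hg hag hcg
    exact ⟨g :: l, hl.cons he hu hw⟩

theorem exists_isSimplePath_of_reach {M : Set (MEdge α)} {e : MEdge α} {u x y : α}
    {p : List (MEdge α)} (hp : IsSimplePath M p u y) (he : e ∈ p) (hxu : Reach M x u) :
    ∃ q, e ∈ q ∧ IsSimplePath M q x y := by
  induction hxu using Relation.ReflTransGen.head_induction_on with
  | refl => exact ⟨p, he, hp⟩
  | head h _ ih =>
    obtain ⟨g, hg, hag, hcg⟩ := h
    obtain ⟨q, heq, hq⟩ := ih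
    exact ⟨g :: q, List.mem_cons_of_mem _ heq, hq.cons hg hag hcg⟩

/-- Metapaths to a single target, in terms of reachability. -/
theorem isMetapath_singleton_iff {E M : Set (MEdge α)} {B : Set α} {x : α} :
    IsMetapath E B {x} M ↔
      M ⊆ E ∧ (∀ e ∈ M, ∀ z ∈ e.inv, (∀ f ∈ M, z ∉ f.out) → z ∈ B) ∧
      (∃ e ∈ M, x ∈ e.out) ∧
      ∀ e ∈ M, (∃ b ∈ B, ∃ u ∈ e.inv, Reach M b u) ∧ ∃ w ∈ e.out, Reach M w x := by
  have hpure : ((⋃ e ∈ M, e.inv) \ (⋃ e ∈ M, e.out)) ⊆ B ↔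
      ∀ e ∈ M, ∀ z ∈ e.inv, (∀ f ∈ M, z ∉ f.out) → z ∈ B := by
    simp only [Set.subset_def, Set.mem_sdiff, Set.mem_iUnion, exists_prop, not_exists, not_and]
    grind
  have hpath : (∀ e ∈ M, ∃ (p : List (MEdge α)) (b y : α),
        b ∈ B ∧ y ∈ ({x} : Set α) ∧ e ∈ p ∧ IsSimplePath M p b y) ↔
      ∀ e ∈ M, (∃ b ∈ B, ∃ u ∈ e.inv, Reach M b u) ∧ ∃ w ∈ e.out, Reach M w x := by
    refine forall₂_congr fun e he => ⟨?_, ?_⟩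
    · rintro ⟨p, b, y, hb, rfl, hep, hp⟩
      obtain ⟨⟨u, hu, hbu⟩, hw⟩ := hp.exists_reach hep
      exact ⟨⟨b, hb, u, hu, hbu⟩, hw⟩
    · rintro ⟨⟨b, hb, u, hu, hbu⟩, w, hw, hwx⟩
      obtain ⟨l, hl⟩ := exists_isSimplePath_cons hwx he hu hw
      obtain ⟨q, heq, hq⟩ := exists_isSimplePath_of_reach hl List.mem_cons_self hbu
      exact ⟨q, b, x, hb, rfl, heq, hq⟩
  rw [IsMetapath, IsRelaxedMetapath, hpure, hpath]
  simp only [Set.singleton_subset_iff, Set.mem_iUnion, exists_prop, and_assoc]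

theorem isMetapath_singleton_edge {E : Set (MEdge α)} {e : MEdge α} {x : α} (he : e ∈ E)
    (hne : e.inv.Nonempty) (hx : x ∈ e.out) : IsMetapath E e.inv {x} {e} := by
  obtain ⟨v, hv⟩ := hne
  refine isMetapath_singleton_iff.2 ⟨by simpa using he, ?_, ⟨e, rfl, hx⟩, ?_⟩
  · rintro _ rfl z hz -
    exact hz
  · rintro _ rfl
    exact ⟨⟨v, hv, v, hv, .refl⟩, x, hx, .refl⟩

/-- A metapath to a single target is nonempty. -/
theorem not_isMetapath_empty {E : Set (MEdge α)} {B : Set α} {x : α} :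
    ¬ IsMetapath E B {x} ∅ := by
  intro h
  obtain ⟨_, _, ⟨e, he, _⟩, _⟩ := isMetapath_singleton_iff.1 h
  exact he

theorem IsMetapath.source_nonempty {E M : Set (MEdge α)} {B : Set α} {x : α}
    (h : IsMetapath E B {x} M) : B.Nonempty := by
  obtain ⟨_, _, ⟨e, he, _⟩, h⟩ := isMetapath_singleton_iff.1 h
  obtain ⟨⟨b, hb, _⟩, _⟩ := h e he
  exact ⟨b, hb⟩

/-- Every source element of an input-dominant metapath reaches the target. -/
theorem IsInputDominant.reach {E M : Set (MEdge α)} {V : Set α} {x v : α}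
    (h : IsInputDominant E V {x} M) (hv : v ∈ V) : Reach M v x := by
  obtain ⟨hME, hpure, hout, hreach⟩ := isMetapath_singleton_iff.1 h.1
  by_cases hex : ∃ e ∈ M, v ∈ e.inv
  · obtain ⟨e, he, hve⟩ := hex
    obtain ⟨_, w, hw, hwx⟩ := hreach e he
    exact .head ⟨e, he, hve, hw⟩ hwx
  · refine absurd (isMetapath_singleton_iff.2 ⟨hME, ?_, hout, ?_⟩)
      (h.2 (V \ {v}) (Set.sdiff_singleton_ssubset.2 hv) M)
    · intro e he z hz hzo
      refine ⟨hpure e he z hz hzo, ?_⟩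
      rintro rfl
      exact hex ⟨e, he, hz⟩
    · intro e he
      obtain ⟨⟨b, hb, u, hu, hbu⟩, hw⟩ := hreach e he
      refine ⟨⟨b, ⟨hb, ?_⟩, u, hu, hbu⟩, hw⟩
      rintro rfl
      rcases hbu.cases_head with rfl | ⟨c, ⟨g, hg, hbg, _⟩, _⟩
      · exact hex ⟨e, he, hu⟩
      · exact hex ⟨g, hg, hbg⟩

/-- An input-dominant metapath whose target belongs to its source has no other source. -/
theorem IsInputDominant.eq_singleton {E M : Set (MEdge α)} {V : Set α} {x : α}
    (h : IsInputDominant E V {x} M) (hx : x ∈ V) : V = {x} := by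
  obtain ⟨hME, hpure, ⟨e₀, he₀, hxe₀⟩, hreach⟩ := isMetapath_singleton_iff.1 h.1
  by_contra hne
  obtain ⟨r, hr, hrx⟩ : ∃ r ∈ V, r ≠ x := by
    by_contra! hall
    exact hne (Set.Subset.antisymm hall (by simpa using hx))
  refine h.2 (V \ {x}) (Set.sdiff_singleton_ssubset.2 hx) M
    (isMetapath_singleton_iff.2 ⟨hME, ?_, ⟨e₀, he₀, hxe₀⟩, ?_⟩)
  · intro e he z hz hzo
    refine ⟨hpure e he z hz hzo, ?_⟩
    rintro rfl
    exact hzo e₀ he₀ hxe₀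
  · intro e he
    obtain ⟨⟨b, hb, u, hu, hbu⟩, hw⟩ := hreach e he
    refine ⟨?_, hw⟩
    by_cases hbx : b = x
    · subst hbx
      exact ⟨r, ⟨hr, hrx⟩, u, hu, (h.reach hr).trans hbu⟩
    · exact ⟨b, ⟨hb, hbx⟩, u, hu, hbu⟩

/-- A metapath in the projection lifts to a metapath with the same source and target in the
original metagraph. -/
theorem IsMetapath.exists_lift {E F : Set (MEdge α)} {X' B : Set α} {x : α}
    (h : IsMetapath (TPP E X') B {x} F) : ∃ G, IsMetapath E B {x} G := by
  obtain ⟨hFE, hpure, ⟨f₀, hf₀, hxf₀⟩, hreach⟩ := isMetapath_singleton_iff.1 h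
  let R : Set α := {y | y = x ∨ ∃ f ∈ F, y ∈ f.inv}
  let G : Set (MEdge α) :=
    {g | ∃ f ∈ F, ∃ y ∈ f.out, y ∈ R ∧ ∃ M, IsDominant E f.inv {y} M ∧ g ∈ M}
  have hdom : ∀ f ∈ F, ∀ y ∈ f.out, y ∈ R → ∃ M ⊆ G, IsDominant E f.inv {y} M := by
    intro f hf y hy hyR
    have hy' := hy
    rw [(hFE hf).2.2] at hy'
    obtain ⟨_, M, hM, _⟩ := hy'
    exact ⟨M, fun g hg => ⟨f, hf, y, hy, hyR, M, hM, hg⟩, hM⟩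
  have hlift : ∀ {a c : α}, c ∈ R → Reach F a c → Reach G a c := by
    intro a c hc hac
    induction hac using Relation.ReflTransGen.head_induction_on with
    | refl => exact .refl
    | @head a d hstep hdc ih =>
      obtain ⟨f, hf, haf, hdf⟩ := hstep
      have hd : d ∈ R := by
        rcases hdc.cases_head with rfl | ⟨_, ⟨g, hg, hdg, _⟩, _⟩
        · exact hc
        · exact .inr ⟨g, hg, hdg⟩
      obtain ⟨M, hMG, hM⟩ := hdom f hf d hdf hd
      exact (Reach.mono hMG (hM.2.reach haf)).trans ih
  refine ⟨G, isMetapath_singleton_iff.2 ⟨?_, ?_, ?_, ?_⟩⟩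
  · rintro g ⟨f, -, y, -, -, M, hM, hg⟩
    exact (isMetapath_singleton_iff.1 hM.1.1).1 hg
  · rintro g ⟨f, hf, y, hy, hyR, M, hM, hg⟩ z hz hzo
    have hzf : z ∈ f.inv := (isMetapath_singleton_iff.1 hM.1.1).2.1 g hg z hz
      fun k hk => hzo k ⟨f, hf, y, hy, hyR, M, hM, hk⟩
    refine hpure f hf z hzf fun k hk hzk => ?_
    obtain ⟨N, hNG, hN⟩ := hdom k hk z hzk (.inr ⟨f, hf, hzf⟩)
    obtain ⟨_, _, ⟨n, hn, hzn⟩, _⟩ := isMetapath_singleton_iff.1 hN.1.1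
    exact hzo n (hNG hn) hzn
  · obtain ⟨M, hMG, hM⟩ := hdom f₀ hf₀ x hxf₀ (.inl rfl)
    obtain ⟨_, _, ⟨n, hn, hxn⟩, _⟩ := isMetapath_singleton_iff.1 hM.1.1
    exact ⟨n, hMG hn, hxn⟩
  · rintro g ⟨f, hf, y, hy, hyR, M, hM, hg⟩
    have hMG : M ⊆ G := fun k hk => ⟨f, hf, y, hy, hyR, M, hM, hk⟩
    obtain ⟨⟨v, hv, u, hu, hvu⟩, w, hw, hwy⟩ := (isMetapath_singleton_iff.1 hM.1.1).2.2.2 g hg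
    have hyx : Reach F y x := by
      rcases hyR with rfl | ⟨k, hk, hyk⟩
      · exact .refl
      · obtain ⟨_, s, hs, hsx⟩ := hreach k hk
        exact .head ⟨k, hk, hyk, hs⟩ hsx
    have hBv : ∃ b ∈ B, Reach F b v := by
      by_cases hvo : ∃ k ∈ F, v ∈ k.out
      · obtain ⟨k, hk, hvk⟩ := hvo
        obtain ⟨⟨b, hb, t, ht, hbt⟩, _⟩ := hreach k hk
        exact ⟨b, hb, hbt.tail ⟨k, hk, ht, hvk⟩⟩
      · exact ⟨v, hpure f hf v hv fun k hk hvk => hvo ⟨k, hk, hvk⟩, .refl⟩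
    obtain ⟨b, hb, hbv⟩ := hBv
    exact ⟨⟨b, hb, u, hu, (hlift (.inr ⟨f, hf, hv⟩) hbv).trans (hvu.mono hMG)⟩,
      w, hw, (hwy.mono hMG).trans (hlift (.inl rfl) hyx)⟩

/-- The projection has the same sources and targets of irreducible dominant metapaths as the
original metagraph. -/
theorem exists_isDominant_irreducible_TPP_iff {E : Set (MEdge α)} {X' V : Set α} {x : α}
    (hV : V ⊆ X') (hx : x ∈ X') :
    (∃ M, IsDominant (TPP E X') V {x} M ∧ Irreducible (TPP E X') X' x M) ↔
      ∃ M, IsDominant E V {x} M ∧ Irreducible E X' x M := by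
  constructor
  · rintro ⟨M, hM, hirr⟩
    obtain ⟨hME, hpure, ⟨e, he, hxe⟩, hreach⟩ := isMetapath_singleton_iff.1 hM.1.1
    have heT := hME he
    obtain ⟨⟨_, _, u, hu, _⟩, _⟩ := hreach e he
    have hmeta := isMetapath_singleton_edge heT ⟨u, hu⟩ hxe
    obtain rfl : {e} = M := by
      by_contra hne
      exact hirr ⟨{e}, (Set.singleton_subset_iff.2 he).ssubset_of_ne hne, e.inv, heT.1, hmeta⟩
    have hsub : e.inv ⊆ V := by
      intro z hz
      by_cases hzo : z ∈ e.out
      · rw [heT.2.2] at hzo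
        obtain ⟨_, N, hN, _⟩ := hzo
        have hinv := hN.2.eq_singleton hz
        obtain ⟨⟨b, hb, s, hs, hbs⟩, _⟩ := hreach e rfl
        have hbe : b ∈ e.inv := by
          rcases hbs.cases_head with rfl | ⟨_, ⟨_, rfl, hbg, _⟩, _⟩
          · exact hs
          · exact hbg
        rw [hinv] at hbe
        exact hbe ▸ hb
      · exact hpure e rfl z hz (by rintro _ rfl; exact hzo)
    obtain rfl : e.inv = V := by
      by_contra hne
      exact hM.2.2 e.inv (hsub.ssubset_of_ne hne) _ hmeta
    rw [heT.2.2] at hxe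
    exact hxe.2
  · rintro ⟨M, hM, hirr⟩
    let e : MEdge α :=
      ⟨V, {y | y ∈ X' ∧ ∃ M, IsDominant E V {y} M ∧ Irreducible E X' y M}⟩
    have heT : e ∈ TPP E X' := ⟨hV, ⟨x, hx, M, hM, hirr⟩, rfl⟩
    have hmeta : IsMetapath (TPP E X') V {x} {e} :=
      isMetapath_singleton_edge heT hM.1.1.source_nonempty ⟨hx, M, hM, hirr⟩
    refine ⟨{e}, ⟨⟨hmeta, ?_⟩, hmeta, ?_⟩, ?_⟩
    · intro F hF
      rw [Set.ssubset_singleton_iff.1 hF]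
      exact not_isMetapath_empty
    · intro B hB F hF
      obtain ⟨G, hG⟩ := hF.exists_lift
      exact hM.2.2 B hB G hG
    · rintro ⟨F, hF, U, -, hFU⟩
      rw [Set.ssubset_singleton_iff.1 hF] at hFU
      exact not_isMetapath_empty hFU

end MG

/-- The transitivity preserving projection is idempotent: if `H = ⟨X,E⟩` is a
metagraph with `X` finite, `X' ⊆ X`, and `H' = ⟨X',E'⟩` is the transitivity
preserving projection of `H` over `X'`, then the transitivity preserving
projection of `H'` over `X'` equals `H'`. -/
theorem stmt_13 {α : Type*} (X : Set α) (E : Set (MEdge α))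
    (hX : X.Finite) (hE : E.Finite)
    (hedges : ∀ e ∈ E, e.inv ⊆ X ∧ e.out ⊆ X)
    (X' : Set α) (hX' : X' ⊆ X) :
    MG.TPP (MG.TPP E X') X' = MG.TPP E X' := by
  ext e
  refine and_congr_right fun hinv => ?_
  have hiff := fun x (hx : x ∈ X') =>
    MG.exists_isDominant_irreducible_TPP_iff (E := E) hinv hx
  have hset : {x | x ∈ X' ∧ ∃ M, MG.IsDominant (MG.TPP E X') e.inv {x} M ∧
        MG.Irreducible (MG.TPP E X') X' x M} =
      {x | x ∈ X' ∧ ∃ M, MG.IsDominant E e.inv {x} M ∧ MG.Irreducible E X' x M} :=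
    Set.ext fun x => and_congr_right (hiff x)
  rw [hset]
  exact and_congr_left' (exists_congr fun x => and_congr_right (hiff x))
end
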